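/- Let λ > 0, δ ∈ (0,1), let n ≥ 2 be even, and suppose μ_o ∈ ℝᵖ with μ_o ≥ 0 coordinatewise satisfies R(μ_o) ≤ ε_o (i.e., μ_o is ε_o-combination good). Draw S ~ Dⁿ i.i.d. and let μ̂ be any minimizer of (λ/2)‖μ‖₂² + R̂_S(μ) over {μ ≥ 0}. Then with probability at least 1 − 2δ, R(μ̂) ≤ ε_o + (λ/2)‖μ_o‖₂² + 2‖μ_o‖₂‖κ‖₂√(2/n) + (1 + ‖μ_o‖₂‖κ‖₂)√(2 log(1/δ)/n) + 4‖κ‖₂√(1/(λn)) + (1 + ‖κ‖₂√(2/λ))√(2 log(1/δ)/n). -/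

import Mathlib

open MeasureTheory Finset

noncomputable section

/-- The ±1 real value of a Boolean label: `true ↦ 1`, `false ↦ -1`.
We encode the label space {−1, 1} by `Bool`. -/
def sgn (b : Bool) : ℝ := if b then 1 else -1

/-- The Euclidean (L2) norm on ℝᵖ. -/
def l2norm {p : ℕ} (μ : Fin p → ℝ) : ℝ := Real.sqrt (∑ i, μ i ^ 2)

/-- The L1 norm on ℝᵖ. -/
def l1norm {p : ℕ} (μ : Fin p → ℝ) : ℝ := ∑ i, |μ i|

/-- The L∞ (supremum) norm on ℝᵖ. -/
def linfnorm {p : ℕ} (μ : Fin p → ℝ) : ℝ := ⨆ i, |μ i|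

/-- The standard inner product on ℝᵖ. -/
def ip {p : ℕ} (μ v : Fin p → ℝ) : ℝ := ∑ i, μ i * v i

/-- The K-space feature map `z(x,x') = (K₁(x,x'),…,K_p(x,x'))`. -/
def zmap {X : Type*} {p : ℕ} (K : Fin p → X → X → ℝ) (x x' : X) : Fin p → ℝ :=
  fun i => K i x x'

/-- The pairwise hinge loss `ℓ(μ, (x,y), (x',y')) = max(0, 1 − y y' ⟨μ, z(x,x')⟩)`. -/
def hinge {X : Type*} {p : ℕ} (K : Fin p → X → X → ℝ) (μ : Fin p → ℝ)
    (w w' : X × Bool) : ℝ :=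
  max 0 (1 - sgn w.2 * sgn w'.2 * ip μ (zmap K w.1 w'.1))

/-- The empirical risk `R̂_S(μ) = (2/(n(n−1))) Σ_{1≤i<j≤n} ℓ(μ, (xᵢ,yᵢ), (xⱼ,yⱼ))`. -/
def empRisk {X : Type*} {p n : ℕ} (K : Fin p → X → X → ℝ)
    (S : Fin n → X × Bool) (μ : Fin p → ℝ) : ℝ :=
  (2 / ((n : ℝ) * ((n : ℝ) - 1))) *
    ∑ i : Fin n, ∑ j : Fin n, if i < j then hinge K μ (S i) (S j) else 0

/-- The true risk `R(μ) = E_{((x,y),(x',y')) ~ D×D}[max(0, 1 − y y' ⟨μ, z(x,x')⟩)]`. -/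
def trueRisk {X : Type*} [MeasurableSpace X] {p : ℕ} (K : Fin p → X → X → ℝ)
    (D : Measure (X × Bool)) (μ : Fin p → ℝ) : ℝ :=
  ∫ w, hinge K μ w.1 w.2 ∂(D.prod D)

/-- Expectation over m i.i.d. Rademacher random variables (uniform on {−1,+1}),
encoded by Booleans mapped to ±1 via `sgn`. -/
def radE {m : ℕ} (f : (Fin m → Bool) → ℝ) : ℝ :=
  (∑ ε : Fin m → Bool, f ε) / 2 ^ m


section BoundedDifferences

variable {Y : Type*} [MeasurableSpace Y]

theorem integrable_of_measurable_of_abs_le {P : Measure Y} [IsFiniteMeasure P] {f : Y → ℝ} {C : ℝ}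
    (hf : Measurable f) (hC : ∀ y, |f y| ≤ C) : Integrable f P :=
  Integrable.of_bound hf.aestronglyMeasurable C (ae_of_all _ hC)

theorem abs_integral_le_of_abs_le {P : Measure Y} [IsProbabilityMeasure P] {f : Y → ℝ} {C : ℝ}
    (hC : ∀ y, |f y| ≤ C) : |∫ y, f y ∂P| ≤ C := by
  simpa using norm_integral_le_of_norm_le_const (μ := P) (f := f) (C := C) (ae_of_all _ hC)

theorem measurable_fin_cons {m : ℕ} :
    Measurable (fun q : Y × (Fin m → Y) => (Fin.cons q.1 q.2 : Fin (m + 1) → Y)) := by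
  refine measurable_pi_iff.2 fun i => ?_
  refine Fin.cases ?_ (fun j => ?_) i
  · simpa using measurable_fst
  · simpa using! (measurable_pi_apply j).comp measurable_snd

theorem measurable_fin_cons_right {m : ℕ} (y : Y) :
    Measurable (fun W : Fin m → Y => (Fin.cons y W : Fin (m + 1) → Y)) :=
  measurable_fin_cons.comp (measurable_const.prodMk measurable_id)

theorem integral_pi_succ (P : Measure Y) [IsProbabilityMeasure P] {m : ℕ}
    {F : (Fin (m + 1) → Y) → ℝ} {C : ℝ} (hF : Measurable F) (hC : ∀ W, |F W| ≤ C) :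
    ∫ W, F W ∂(Measure.pi fun _ => P) =
      ∫ y, ∫ W, F (Fin.cons y W) ∂(Measure.pi fun _ => P) ∂P := by
  have h := (measurePreserving_piFinSuccAbove (fun _ : Fin (m + 1) => P) 0).symm
  rw [← h.integral_comp' F, integral_prod]
  · simp [MeasurableEquiv.piFinSuccAbove, Fin.insertNthEquiv, Fin.insertNth_zero']
  · exact integrable_of_measurable_of_abs_le (hF.comp (MeasurableEquiv.measurable _))
      fun _ => hC _

theorem measurable_integral_fin_cons (P : Measure Y) [IsProbabilityMeasure P] {m : ℕ}
    {F : (Fin (m + 1) → Y) → ℝ} (hF : Measurable F) :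
    Measurable fun y => ∫ W, F (Fin.cons y W) ∂(Measure.pi fun _ => P) :=
  ((hF.comp measurable_fin_cons).stronglyMeasurable.integral_prod_right').measurable

/-- Moment generating function form of McDiarmid's inequality. -/
theorem integral_exp_sub_integral_le (P : Measure Y) [IsProbabilityMeasure P] {c : ℝ} (t : ℝ) :
    ∀ {n : ℕ} {g : (Fin n → Y) → ℝ} {C : ℝ}, Measurable g → (∀ W, |g W| ≤ C) →
      (∀ W i z, |g (Function.update W i z) - g W| ≤ c) →
      ∫ W, Real.exp (t * (g W - ∫ V, g V ∂(Measure.pi fun _ => P))) ∂(Measure.pi fun _ => P) ≤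
        Real.exp (n * (c / 2) ^ 2 * t ^ 2 / 2) := by
  intro n
  induction n with
  | zero =>
    intro g C _ _ _
    have hg : g = fun _ => g default := by
      funext W
      rw [Subsingleton.elim W default]
    rw [hg]
    simp
  | succ n ih =>
    intro g C hg hC hd
    set G : Y → ℝ := fun y => ∫ W, g (Fin.cons y W) ∂(Measure.pi fun _ => P) with hG
    have hGm : Measurable G := measurable_integral_fin_cons P hg
    have hinteg : ∀ y, Integrable (fun W : Fin n → Y => g (Fin.cons y W))
        (Measure.pi fun _ => P) := fun y =>
      integrable_of_measurable_of_abs_le (hg.comp (measurable_fin_cons_right y)) fun _ => hC _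
    have hE : ∫ V, g V ∂(Measure.pi fun _ => P) = ∫ y, G y ∂P := integral_pi_succ P hg hC
    have hGd : ∀ y y', |G y - G y'| ≤ c := by
      intro y y'
      rw [hG]
      simp only
      rw [← integral_sub (hinteg y) (hinteg y')]
      refine abs_integral_le_of_abs_le fun W => ?_
      have := hd (Fin.cons y' W) 0 y
      rwa [Fin.update_cons_zero] at this
    have hGC : ∀ y, |G y| ≤ C := fun y => abs_integral_le_of_abs_le fun W => hC _
    obtain ⟨y₀⟩ : Nonempty Y := P.nonempty_of_neZero
    have hc : 0 ≤ c := (abs_nonneg _).trans (hGd y₀ y₀)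
    have hbdd : BddBelow (Set.range G) :=
      ⟨-C, by rintro _ ⟨y, rfl⟩; exact (abs_le.1 (hGC y)).1⟩
    have hIcc : ∀ y, G y ∈ Set.Icc (⨅ y, G y) ((⨅ y, G y) + c) := by
      intro y
      refine ⟨ciInf_le hbdd y, ?_⟩
      have : G y - c ≤ ⨅ y, G y := by
        have : Nonempty Y := ⟨y₀⟩
        exact le_ciInf fun y' => by linarith [(abs_le.1 (hGd y y')).2]
      linarith
    have hsub := (ProbabilityTheory.hasSubgaussianMGF_of_mem_Icc hGm.aemeasurable
      (ae_of_all P hIcc)).mgf_le t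
    have hsub' : ∫ y, Real.exp (t * (G y - ∫ y, G y ∂P)) ∂P ≤
        Real.exp ((c / 2) ^ 2 * t ^ 2 / 2) := by
      simpa [ProbabilityTheory.mgf, abs_of_nonneg hc] using hsub
    have hEC : |∫ y, G y ∂P| ≤ C := abs_integral_le_of_abs_le hGC
    have hexp : ∀ a : ℝ, |a| ≤ C → |Real.exp (t * (a - ∫ y, G y ∂P))| ≤
        Real.exp (|t| * (C + C)) := by
      intro a ha
      rw [Real.abs_exp, Real.exp_le_exp]
      refine (le_abs_self _).trans ?_
      rw [abs_mul]
      refine mul_le_mul_of_nonneg_left ?_ (abs_nonneg _)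
      exact (abs_sub _ _).trans (add_le_add ha hEC)
    rw [hE, integral_pi_succ P (C := Real.exp (|t| * (C + C))) (by fun_prop)
      fun W => hexp _ (hC W)]
    calc ∫ y, ∫ W, Real.exp (t * (g (Fin.cons y W) - ∫ y, G y ∂P)) ∂(Measure.pi fun _ => P) ∂P
        ≤ ∫ y, Real.exp (n * (c / 2) ^ 2 * t ^ 2 / 2) *
            Real.exp (t * (G y - ∫ y, G y ∂P)) ∂P := by
          refine integral_mono ?_ ?_ fun y => ?_
          · refine integrable_of_measurable_of_abs_le
              (measurable_integral_fin_cons P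
                (F := fun W => Real.exp (t * (g W - ∫ y, G y ∂P))) (by fun_prop))
              (C := Real.exp (|t| * (C + C))) fun y => ?_
            exact abs_integral_le_of_abs_le fun W => hexp _ (hC _)
          · exact (integrable_of_measurable_of_abs_le (by fun_prop)
              fun y => hexp _ (hGC y)).const_mul _
          · have hsplit : ∀ W : Fin n → Y, Real.exp (t * (g (Fin.cons y W) - ∫ y, G y ∂P)) =
                Real.exp (t * (g (Fin.cons y W) - G y)) * Real.exp (t * (G y - ∫ y, G y ∂P)) := by
              intro W
              rw [← Real.exp_add]
              ring_nf
            simp only [hsplit]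
            rw [integral_mul_const]
            refine mul_le_mul_of_nonneg_right ?_ (Real.exp_pos _).le
            refine ih (g := fun W => g (Fin.cons y W)) (hg.comp (measurable_fin_cons_right y))
              (fun W => hC _) fun W i z => ?_
            have := hd (Fin.cons y W) i.succ z
            rwa [← Fin.cons_update] at this
      _ ≤ Real.exp (n * (c / 2) ^ 2 * t ^ 2 / 2) * Real.exp ((c / 2) ^ 2 * t ^ 2 / 2) := by
          rw [integral_const_mul]
          exact mul_le_mul_of_nonneg_left hsub' (Real.exp_pos _).le
      _ = Real.exp ((n + 1 : ℕ) * (c / 2) ^ 2 * t ^ 2 / 2) := by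
          rw [← Real.exp_add]
          push_cast
          ring_nf

/-- **McDiarmid's inequality** for a bounded function of i.i.d. variables. -/
theorem measureReal_ge_le_of_bounded_differences (P : Measure Y) [IsProbabilityMeasure P]
    {n : ℕ} {g : (Fin n → Y) → ℝ} {C c t : ℝ} (hg : Measurable g) (hC : ∀ W, |g W| ≤ C)
    (hd : ∀ W i z, |g (Function.update W i z) - g W| ≤ c) (ht : 0 ≤ t) :
    (Measure.pi fun _ => P).real {W | t ≤ g W - ∫ V, g V ∂(Measure.pi fun _ => P)} ≤
      Real.exp (-t ^ 2 / (2 * (n * (c / 2) ^ 2))) := by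
  have h : ProbabilityTheory.HasSubgaussianMGF
      (fun W => g W - ∫ V, g V ∂(Measure.pi fun _ => P)) ⟨n * (c / 2) ^ 2, by positivity⟩
      (Measure.pi fun _ => P) := by
    refine ⟨fun s => ?_, fun s => integral_exp_sub_integral_le P s hg hC hd⟩
    refine ProbabilityTheory.integrable_exp_mul_of_mem_Icc (a := -C - C) (b := C + C)
      (by fun_prop) (ae_of_all _ fun W => ?_)
    have h1 := abs_le.1 (hC W)
    have h2 := abs_le.1 (abs_integral_le_of_abs_le (P := Measure.pi fun _ => P) hC)
    exact ⟨by linarith, by linarith⟩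
  exact h.measure_ge_le ht

end BoundedDifferences

section Symmetrization

/-- The uniform distribution on the two signs. -/
def rademacher : Measure Bool := (2 : ENNReal)⁻¹ • (Measure.dirac true + Measure.dirac false)

instance : IsProbabilityMeasure rademacher where
  measure_univ := by
    simp [rademacher, ENNReal.inv_two_add_inv_two]

theorem integral_rademacher (F : Bool → ℝ) : ∫ b, F b ∂rademacher = (F true + F false) / 2 := by
  rw [rademacher, integral_smul_measure, integral_add_measure Integrable.of_finite
    Integrable.of_finite, integral_dirac, integral_dirac]
  simp
  ring

theorem abs_sgn (b : Bool) : |sgn b| = 1 := by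
  cases b <;> simp [sgn]

theorem measurable_sgn : Measurable sgn := measurable_of_countable _

variable {ι : Type*} {Y Y' : Type*} [MeasurableSpace Y] [MeasurableSpace Y']

theorem integrable_integral_of_abs_le (P : Measure Y) [IsFiniteMeasure P] (Q : Measure Y')
    [IsProbabilityMeasure Q] {F : Y → Y' → ℝ} {C : ℝ} (hF : Measurable (Function.uncurry F))
    (hC : ∀ y y', |F y y'| ≤ C) : Integrable (fun y => ∫ y', F y y' ∂Q) P :=
  integrable_of_measurable_of_abs_le hF.stronglyMeasurable.integral_prod_right.measurable
    fun y => abs_integral_le_of_abs_le (hC y)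

theorem bddAbove_range_of_abs_le {a : ι → ℝ} {C : ℝ} (h : ∀ k, |a k| ≤ C) :
    BddAbove (Set.range a) :=
  ⟨C, by rintro _ ⟨k, rfl⟩; exact (abs_le.1 (h k)).2⟩

variable [Nonempty ι]

theorem abs_iSup_le_of_abs_le {a : ι → ℝ} {C : ℝ} (h : ∀ k, |a k| ≤ C) : |⨆ k, a k| ≤ C := by
  obtain ⟨k⟩ := ‹Nonempty ι›
  have : Nonempty ι := ⟨k⟩
  exact abs_le.2 ⟨(abs_le.1 (h k)).1.trans (le_ciSup (bddAbove_range_of_abs_le h) k),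
    ciSup_le fun k => (abs_le.1 (h k)).2⟩

/-- One coordinate of the Ledoux–Talagrand contraction principle. -/
theorem iSup_add_iSup_sub_le {u f v : ι → ℝ} {C : ℝ} (hp : ∀ k, |u k + v k| ≤ C)
    (hm : ∀ k, |u k - v k| ≤ C) (hfv : ∀ k l, |f k - f l| ≤ |v k - v l|) :
    (⨆ k, (u k + f k)) + ⨆ k, (u k - f k) ≤ (⨆ k, (u k + v k)) + ⨆ k, (u k - v k) := by
  rw [← le_sub_iff_add_le]
  refine ciSup_le fun k => ?_
  rw [le_sub_comm]
  refine ciSup_le fun l => ?_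
  have h1 := le_ciSup (bddAbove_range_of_abs_le hp)
  have h2 := le_ciSup (bddAbove_range_of_abs_le hm)
  have h3 := (le_abs_self _).trans (hfv k l)
  rcases abs_cases (v k - v l) with h | h
  · linarith [h1 k, h2 l]
  · linarith [h1 l, h2 k]

variable [Countable ι]

/-- Symmetrization and contraction for a single random variable, in the presence of an
arbitrary offset. -/
theorem integral_iSup_sub_le_integral_rademacher (P : Measure Y) [IsProbabilityMeasure P]
    {f v : ι → Y → ℝ} {C : ℝ} (hf : ∀ k, Measurable (f k)) (hv : ∀ k, Measurable (v k))
    (hfC : ∀ k y, |f k y| ≤ C) (hvC : ∀ k y, |v k y| ≤ C)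
    (hfv : ∀ k l y, |f k y - f l y| ≤ |v k y - v l y|) {u : ι → ℝ} {U : ℝ}
    (hu : ∀ k, |u k| ≤ U) :
    ∫ y, ⨆ k, (u k + (∫ x, f k x ∂P - f k y)) ∂P ≤
      ∫ q, ⨆ k, (u k + 2 * sgn q.2 * v k q.1) ∂(P.prod rademacher) := by
  have hadd : ∀ {a b : ℝ}, |a| ≤ U → |b| ≤ C → |a + 2 * b| ≤ U + 2 * C := by
    intro a b ha hb
    rw [abs_le] at *
    constructor <;> linarith
  have hsub : ∀ {a b : ℝ}, |a| ≤ U → |b| ≤ C → |a - 2 * b| ≤ U + 2 * C := by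
    intro a b ha hb
    rw [abs_le] at *
    constructor <;> linarith
  have hfp : Integrable (fun y => ⨆ k, (u k + 2 * f k y)) P :=
    integrable_of_measurable_of_abs_le (by fun_prop)
      fun y => abs_iSup_le_of_abs_le fun k => hadd (hu k) (hfC k y)
  have hfm : Integrable (fun y => ⨆ k, (u k - 2 * f k y)) P :=
    integrable_of_measurable_of_abs_le (by fun_prop)
      fun y => abs_iSup_le_of_abs_le fun k => hsub (hu k) (hfC k y)
  have hvp : Integrable (fun y => ⨆ k, (u k + 2 * v k y)) P :=
    integrable_of_measurable_of_abs_le (by fun_prop)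
      fun y => abs_iSup_le_of_abs_le fun k => hadd (hu k) (hvC k y)
  have hvm : Integrable (fun y => ⨆ k, (u k - 2 * v k y)) P :=
    integrable_of_measurable_of_abs_le (by fun_prop)
      fun y => abs_iSup_le_of_abs_le fun k => hsub (hu k) (hvC k y)
  have hmean : ∀ k, u k + 2 * ∫ x, f k x ∂P ≤ ∫ x, ⨆ k, (u k + 2 * f k x) ∂P := by
    intro k
    have hi := (integrable_of_measurable_of_abs_le (P := P) (hf k) (hfC k)).const_mul 2
    calc u k + 2 * ∫ x, f k x ∂P = ∫ x, (u k + 2 * f k x) ∂P := by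
          rw [integral_add (integrable_const _) hi, integral_const_mul]
          simp
      _ ≤ _ := integral_mono ((integrable_const _).add hi) hfp fun x =>
          le_ciSup (bddAbove_range_of_abs_le fun k => hadd (hu k) (hfC k x)) k
  have hE : ∀ k, |∫ x, f k x ∂P| ≤ C := fun k => abs_integral_le_of_abs_le (hfC k)
  calc ∫ y, ⨆ k, (u k + (∫ x, f k x ∂P - f k y)) ∂P
      ≤ ∫ y, ((∫ x, ⨆ k, (u k + 2 * f k x) ∂P) + ⨆ k, (u k - 2 * f k y)) / 2 ∂P := by
        refine integral_mono (integrable_of_measurable_of_abs_le (C := U + 2 * C)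
          (by fun_prop) fun y => abs_iSup_le_of_abs_le fun k => ?_)
          (((integrable_const _).add hfm).div_const 2) fun y => ciSup_le fun k => ?_
        · have h1 := abs_le.1 (hu k)
          have h2 := abs_le.1 (hE k)
          have h3 := abs_le.1 (hfC k y)
          exact abs_le.2 ⟨by linarith, by linarith⟩
        · have h1 := hmean k
          have h2 := le_ciSup (bddAbove_range_of_abs_le fun k => hsub (hu k) (hfC k y)) k
          simp only at h2 ⊢
          linarith
    _ = ∫ y, ((⨆ k, (u k + 2 * f k y)) + ⨆ k, (u k - 2 * f k y)) / 2 ∂P := by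
        rw [integral_div, integral_div, integral_add (integrable_const _) hfm,
          integral_add hfp hfm]
        simp
    _ ≤ ∫ y, ((⨆ k, (u k + 2 * v k y)) + ⨆ k, (u k - 2 * v k y)) / 2 ∂P := by
        refine integral_mono ((hfp.add hfm).div_const 2) ((hvp.add hvm).div_const 2) fun y => ?_
        refine div_le_div_of_nonneg_right ?_ zero_le_two
        refine iSup_add_iSup_sub_le (C := U + 2 * C) (fun k => hadd (hu k) (hvC k y))
          (fun k => hsub (hu k) (hvC k y)) fun k l => ?_
        rw [← mul_sub, ← mul_sub, abs_mul, abs_mul]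
        exact mul_le_mul_of_nonneg_left (hfv k l y) (abs_nonneg _)
    _ = _ := by
        have hs := measurable_sgn
        rw [integral_prod]
        · simp only [integral_rademacher]
          simp [sgn, sub_eq_add_neg]
        · refine integrable_of_measurable_of_abs_le (C := U + 2 * C) (by fun_prop)
            fun q => abs_iSup_le_of_abs_le fun k => ?_
          rw [mul_assoc]
          refine hadd (hu k) ?_
          rw [abs_mul, abs_sgn, one_mul]
          exact hvC k q.1

theorem abs_add_sum_le {m : ℕ} {a A B : ℝ} {b : Fin m → ℝ} (ha : |a| ≤ A) (hb : ∀ j, |b j| ≤ B) :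
    |a + ∑ j, b j| ≤ A + m * B := by
  refine (abs_add_le _ _).trans (add_le_add ha ((abs_sum_le_sum_abs _ _).trans ?_))
  simpa using sum_le_card_nsmul univ (fun j => |b j|) B fun j _ => hb j

/-- Replace i.i.d. summands of a supremum one at a time. -/
theorem integral_pi_iSup_le (P : Measure Y) [IsProbabilityMeasure P] (Q : Measure Y')
    [IsProbabilityMeasure Q] {g : ι → Y → ℝ} {h : ι → Y' → ℝ} {C : ℝ}
    (hg : ∀ k, Measurable (g k)) (hh : ∀ k, Measurable (h k))
    (hgC : ∀ k y, |g k y| ≤ C) (hhC : ∀ k y, |h k y| ≤ C)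
    (hstep : ∀ (u : ι → ℝ) (U : ℝ), (∀ k, |u k| ≤ U) →
      ∫ y, ⨆ k, (u k + g k y) ∂P ≤ ∫ y, ⨆ k, (u k + h k y) ∂Q) :
    ∀ {m : ℕ} {u : ι → ℝ} {U : ℝ}, (∀ k, |u k| ≤ U) →
      ∫ W, ⨆ k, (u k + ∑ j : Fin m, g k (W j)) ∂(Measure.pi fun _ => P) ≤
        ∫ W, ⨆ k, (u k + ∑ j : Fin m, h k (W j)) ∂(Measure.pi fun _ => Q) := by
  intro m
  induction m with
  | zero => simp
  | succ m ih =>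
    intro u U hu
    have hug : ∀ k y, |u k + g k y| ≤ U + C := fun k y =>
      (abs_add_le _ _).trans (add_le_add (hu k) (hgC k y))
    have huh : ∀ k (W : Fin m → Y'), |u k + ∑ j, h k (W j)| ≤ U + m * C := fun k W =>
      abs_add_sum_le (hu k) fun j => hhC k (W j)
    have hgb : ∀ y (W : Fin m → Y), |⨆ k, (u k + g k y + ∑ j, g k (W j))| ≤ U + C + m * C :=
      fun y W => abs_iSup_le_of_abs_le fun k => abs_add_sum_le (hug k y) fun j => hgC k (W j)
    have hmb : ∀ y (W : Fin m → Y'), |⨆ k, (u k + g k y + ∑ j, h k (W j))| ≤ U + C + m * C :=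
      fun y W => abs_iSup_le_of_abs_le fun k => abs_add_sum_le (hug k y) fun j => hhC k (W j)
    have hhb : ∀ y (W : Fin m → Y'), |⨆ k, (u k + ∑ j, h k (W j) + h k y)| ≤ U + m * C + C :=
      fun y W => abs_iSup_le_of_abs_le fun k =>
        (abs_add_le _ _).trans (add_le_add (huh k W) (hhC k y))
    have hm1 : Measurable fun q : Y × (Fin m → Y) =>
        ⨆ k, (u k + g k q.1 + ∑ j, g k (q.2 j)) := by fun_prop
    have hm2 : Measurable fun q : Y × (Fin m → Y') =>
        ⨆ k, (u k + g k q.1 + ∑ j, h k (q.2 j)) := by fun_prop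
    have hm3 : Measurable fun q : (Fin m → Y') × Y =>
        ⨆ k, (u k + ∑ j, h k (q.1 j) + g k q.2) := by fun_prop
    have hm4 : Measurable fun q : (Fin m → Y') × Y' =>
        ⨆ k, (u k + ∑ j, h k (q.1 j) + h k q.2) := by fun_prop
    calc ∫ W, ⨆ k, (u k + ∑ j : Fin (m + 1), g k (W j)) ∂(Measure.pi fun _ => P)
        = ∫ y, ∫ W, ⨆ k, (u k + g k y + ∑ j : Fin m, g k (W j)) ∂(Measure.pi fun _ => P) ∂P := by
          rw [integral_pi_succ P (C := U + (m + 1 : ℕ) * C) (by fun_prop)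
            fun W => abs_iSup_le_of_abs_le fun k => abs_add_sum_le (hu k) fun j => hgC k (W j)]
          simp [Fin.sum_univ_succ, add_assoc]
      _ ≤ ∫ y, ∫ W, ⨆ k, (u k + g k y + ∑ j : Fin m, h k (W j))
            ∂(Measure.pi fun _ => Q) ∂P := by
          exact integral_mono (integrable_integral_of_abs_le P _ hm1 hgb)
            (integrable_integral_of_abs_le P _ hm2 hmb) fun y => ih (hug · y)
      _ = ∫ W, ∫ y, ⨆ k, (u k + ∑ j : Fin m, h k (W j) + g k y)
            ∂P ∂(Measure.pi fun _ => Q) := by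
          rw [integral_integral_swap
            (integrable_of_measurable_of_abs_le hm2 fun q => hmb q.1 q.2)]
          simp only [add_right_comm]
      _ ≤ ∫ W, ∫ y, ⨆ k, (u k + ∑ j : Fin m, h k (W j) + h k y)
            ∂Q ∂(Measure.pi fun _ => Q) := by
          exact integral_mono (integrable_integral_of_abs_le _ P hm3
            fun W y => by simpa only [add_right_comm] using hmb y W)
            (integrable_integral_of_abs_le _ Q hm4 fun W y => hhb y W) fun W => hstep _ _ (huh · W)
      _ = ∫ y, ∫ W, ⨆ k, (u k + ∑ j : Fin m, h k (W j) + h k y)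
            ∂(Measure.pi fun _ => Q) ∂Q := by
          exact integral_integral_swap
            (integrable_of_measurable_of_abs_le hm4 fun q => hhb q.2 q.1)
      _ = _ := by
          rw [integral_pi_succ Q (C := U + (m + 1 : ℕ) * C) (by fun_prop)
            fun W => abs_iSup_le_of_abs_le fun k => abs_add_sum_le (hu k) fun j => hhC k (W j)]
          simp [Fin.sum_univ_succ, add_comm, add_left_comm]

end Symmetrization

section EuclideanNorm

variable {p : ℕ}

theorem l2norm_nonneg (v : Fin p → ℝ) : 0 ≤ l2norm v := Real.sqrt_nonneg _

theorem l2norm_sq (v : Fin p → ℝ) : l2norm v ^ 2 = ∑ i, v i ^ 2 :=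
  Real.sq_sqrt (sum_nonneg fun _ _ => sq_nonneg _)

theorem l2norm_le_l2norm_of_abs_le {v w : Fin p → ℝ} (h : ∀ i, |v i| ≤ w i) :
    l2norm v ≤ l2norm w :=
  Real.sqrt_le_sqrt (sum_le_sum fun i _ => sq_le_sq' (abs_le.1 (h i)).1 (abs_le.1 (h i)).2)

theorem abs_ip_le (v w : Fin p → ℝ) : |ip v w| ≤ l2norm v * l2norm w := by
  refine abs_le_of_sq_le_sq ?_ (mul_nonneg (l2norm_nonneg _) (l2norm_nonneg _))
  rw [mul_pow, l2norm_sq, l2norm_sq]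
  exact sum_mul_sq_le_sq_mul_sq _ _ _

end EuclideanNorm

section RademacherComplexity

variable {Y : Type*} [MeasurableSpace Y]

theorem sq_integral_le_integral_sq (P : Measure Y) [IsProbabilityMeasure P] {f : Y → ℝ} {C : ℝ}
    (hf : Measurable f) (hC : ∀ y, |f y| ≤ C) : (∫ y, f y ∂P) ^ 2 ≤ ∫ y, f y ^ 2 ∂P := by
  have hi := integrable_of_measurable_of_abs_le (P := P) hf hC
  set e := ∫ y, f y ∂P with he
  calc e ^ 2 = ∫ y, (2 * e * f y - e ^ 2) ∂P := by
        rw [integral_sub (hi.const_mul _) (integrable_const _), integral_const_mul, ← he]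
        simp
        ring
    _ ≤ _ := by
        refine integral_mono ((hi.const_mul _).sub (integrable_const _))
          (integrable_of_measurable_of_abs_le (C := C ^ 2) (by fun_prop) fun y => ?_) fun y => ?_
        · rw [abs_pow]
          exact pow_le_pow_left₀ (abs_nonneg _) (hC y) 2
        · simp only
          nlinarith [sq_nonneg (f y - e)]

theorem integral_sq_add_sum_le (Q : Measure Y) [IsProbabilityMeasure Q] {ψ : Y → ℝ} {C : ℝ}
    (hψ : Measurable ψ) (hC : ∀ y, |ψ y| ≤ C) (h0 : ∫ y, ψ y ∂Q = 0) :
    ∀ (m : ℕ) (a : ℝ),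
      ∫ W, (a + ∑ j : Fin m, ψ (W j)) ^ 2 ∂(Measure.pi fun _ => Q) ≤ a ^ 2 + m * C ^ 2 := by
  intro m
  induction m with
  | zero => simp
  | succ m ih =>
    intro a
    have hb : ∀ W : Fin (m + 1) → Y, |(a + ∑ j, ψ (W j)) ^ 2| ≤ (|a| + (m + 1 : ℕ) * C) ^ 2 := by
      intro W
      rw [abs_pow]
      exact pow_le_pow_left₀ (abs_nonneg _) (abs_add_sum_le le_rfl fun j => hC (W j)) 2
    have hi := integrable_of_measurable_of_abs_le (P := Q) hψ hC
    rw [integral_pi_succ Q (by fun_prop) hb]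
    calc ∫ y, ∫ W, (a + ∑ j : Fin (m + 1), ψ ((Fin.cons y W : Fin (m + 1) → Y) j)) ^ 2
          ∂(Measure.pi fun _ => Q) ∂Q
        ≤ ∫ y, (2 * a * ψ y + (a ^ 2 + C ^ 2 + m * C ^ 2)) ∂Q := by
          refine integral_mono (integrable_integral_of_abs_le Q _
            (F := fun y W => (a + ∑ j : Fin (m + 1), ψ ((Fin.cons y W : Fin (m + 1) → Y) j)) ^ 2)
            ?_ fun y W => hb _) ((hi.const_mul _).add (integrable_const _)) fun y => ?_
          · exact (show Measurable fun W : Fin (m + 1) → Y => (a + ∑ j, ψ (W j)) ^ 2 by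
              fun_prop).comp measurable_fin_cons
          · have h := ih (a + ψ y)
            have hs := sq_le_sq' (abs_le.1 (hC y)).1 (abs_le.1 (hC y)).2
            simp only [Fin.sum_univ_succ, Fin.cons_zero, Fin.cons_succ, ← add_assoc]
            nlinarith
      _ = _ := by
          rw [integral_add (hi.const_mul _) (integrable_const _), integral_const_mul, h0]
          simp
          ring

variable {ι : Type*} [Nonempty ι] [Countable ι] {p : ℕ}

/-- Rademacher complexity bound for Lipschitz losses composed with a ball of linear functionals. -/
theorem integral_iSup_sum_deviation_le (P : Measure Y) [IsProbabilityMeasure P]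
    {ξ : Y → Fin p → ℝ} {b : Fin p → ℝ} (hξ : ∀ i, Measurable fun y => ξ y i)
    (hb : ∀ y i, |ξ y i| ≤ b i) {μ : ι → Fin p → ℝ} {B : ℝ} (hμ : ∀ k, l2norm (μ k) ≤ B)
    {f : ι → Y → ℝ} {C : ℝ} (hf : ∀ k, Measurable (f k)) (hC : ∀ k y, |f k y| ≤ C)
    (hlip : ∀ k l y, |f k y - f l y| ≤ |ip (μ k) (ξ y) - ip (μ l) (ξ y)|) (m : ℕ) :
    ∫ W, ⨆ k, ∑ j : Fin m, (∫ y, f k y ∂P - f k (W j)) ∂(Measure.pi fun _ => P) ≤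
      2 * B * (l2norm b * √m) := by
  obtain ⟨y₀⟩ : Nonempty Y := P.nonempty_of_neZero
  obtain ⟨k₀⟩ := id ‹Nonempty ι›
  have hC0 : 0 ≤ C := (abs_nonneg _).trans (hC k₀ y₀)
  have hB0 : 0 ≤ B := (l2norm_nonneg _).trans (hμ k₀)
  have hBb : 0 ≤ B * l2norm b := mul_nonneg hB0 (l2norm_nonneg _)
  have hs := measurable_sgn
  set v : ι → Y → ℝ := fun k y => ip (μ k) (ξ y) with hv
  have hvm : ∀ k, Measurable (v k) := fun k => by
    simp only [hv, ip]
    fun_prop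
  have hvB : ∀ k y, |v k y| ≤ B * l2norm b := fun k y =>
    (abs_ip_le _ _).trans (mul_le_mul (hμ k) (l2norm_le_l2norm_of_abs_le (hb y))
      (l2norm_nonneg _) hB0)
  set Q := P.prod rademacher with hQ
  set ψ : Fin p → Y × Bool → ℝ := fun i q => 2 * sgn q.2 * ξ q.1 i with hψ
  have hψm : ∀ i, Measurable (ψ i) := fun i => by
    have := hξ i
    simp only [hψ]
    fun_prop
  have hψb : ∀ i q, |ψ i q| ≤ 2 * b i := fun i q => by
    simp only [hψ]
    rw [abs_mul, abs_mul, abs_sgn, abs_two, mul_one]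
    exact mul_le_mul_of_nonneg_left (hb _ _) zero_le_two
  have hψ0 : ∀ i, ∫ q, ψ i q ∂Q = 0 := fun i => by
    rw [hQ, integral_prod _ (integrable_of_measurable_of_abs_le (hψm i) (hψb i))]
    simp [hψ, integral_rademacher, sgn]
  set V : (Fin m → Y × Bool) → Fin p → ℝ := fun W i => ∑ j, ψ i (W j) with hV
  have hVm : ∀ i, Measurable fun W => V W i := fun i => by
    simp only [hV]
    fun_prop
  have hVb : ∀ W i, |V W i| ≤ m * (2 * b i) := fun W i => by
    simpa using abs_add_sum_le (abs_zero.le) fun j => hψb i (W j)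
  have hnm : Measurable fun W => l2norm (V W) := by
    simp only [l2norm]
    fun_prop
  have hnb : ∀ W, |l2norm (V W)| ≤ l2norm fun i => m * (2 * b i) := fun W => by
    rw [abs_of_nonneg (l2norm_nonneg _)]
    exact l2norm_le_l2norm_of_abs_le (hVb W)
  have hsq : ∫ W, l2norm (V W) ∂(Measure.pi fun _ => Q) ≤ 2 * (l2norm b * √m) := by
    refine le_of_sq_le_sq ?_ (by have := l2norm_nonneg b; positivity)
    calc (∫ W, l2norm (V W) ∂(Measure.pi fun _ => Q)) ^ 2
        ≤ ∫ W, l2norm (V W) ^ 2 ∂(Measure.pi fun _ => Q) := sq_integral_le_integral_sq _ hnm hnb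
      _ = ∑ i, ∫ W, V W i ^ 2 ∂(Measure.pi fun _ => Q) := by
          simp only [l2norm_sq]
          refine integral_finsetSum _ fun i _ => integrable_of_measurable_of_abs_le
            (C := (m * (2 * b i)) ^ 2) ((hVm i).pow_const 2) fun W => ?_
          rw [abs_pow]
          exact pow_le_pow_left₀ (abs_nonneg _) (hVb W i) 2
      _ ≤ ∑ i, m * (2 * b i) ^ 2 := by
          refine sum_le_sum fun i _ => ?_
          simpa using integral_sq_add_sum_le Q (hψm i) (hψb i) (hψ0 i) m 0
      _ = (2 * (l2norm b * √m)) ^ 2 := by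
          rw [mul_pow, mul_pow, l2norm_sq, Real.sq_sqrt (Nat.cast_nonneg m), sum_mul, mul_sum]
          exact sum_congr rfl fun i _ => by ring
  have hstep := integral_pi_iSup_le P Q (g := fun k y => ∫ x, f k x ∂P - f k y)
    (h := fun k q => 2 * sgn q.2 * v k q.1) (C := 2 * C + 2 * (B * l2norm b))
    (fun k => by fun_prop) (fun k => by fun_prop)
    (fun k y => by
      have h1 := abs_le.1 (abs_integral_le_of_abs_le (P := P) (hC k))
      have h2 := abs_le.1 (hC k y)
      exact abs_le.2 ⟨by linarith, by linarith⟩)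
    (fun k q => by
      rw [abs_mul, abs_mul, abs_sgn, abs_two, mul_one]
      linarith [hvB k q.1])
    (fun u U hu => integral_iSup_sub_le_integral_rademacher P (C := C + B * l2norm b) hf hvm
      (fun k y => (hC k y).trans (by linarith)) (fun k y => (hvB k y).trans (by linarith))
      hlip hu)
    (m := m) (u := fun _ => 0) (U := 0) (fun _ => abs_zero.le)
  simp only [zero_add] at hstep
  have hsum : ∀ k W, ∑ j : Fin m, 2 * sgn (W j).2 * v k (W j).1 = ip (μ k) (V W) := by
    intro k W
    simp only [hv, hV, hψ, ip, mul_sum]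
    rw [sum_comm]
    exact sum_congr rfl fun i _ => sum_congr rfl fun j _ => by ring
  simp only [hsum] at hstep
  refine hstep.trans ?_
  have hle : ∀ k W, |ip (μ k) (V W)| ≤ B * l2norm (V W) := fun k W =>
    (abs_ip_le _ _).trans (mul_le_mul_of_nonneg_right (hμ k) (l2norm_nonneg _))
  calc ∫ W, ⨆ k, ip (μ k) (V W) ∂(Measure.pi fun _ => Q)
      ≤ ∫ W, B * l2norm (V W) ∂(Measure.pi fun _ => Q) := by
        refine integral_mono (integrable_of_measurable_of_abs_le
          (C := B * l2norm fun i => m * (2 * b i)) ?_ fun W => ?_)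
          ((integrable_of_measurable_of_abs_le hnm hnb).const_mul _)
          fun W => ciSup_le fun k => (le_abs_self _).trans (hle k W)
        · simp only [ip]
          fun_prop
        · exact abs_iSup_le_of_abs_le fun k => (hle k W).trans
            (mul_le_mul_of_nonneg_left ((le_abs_self _).trans (hnb W)) hB0)
    _ ≤ B * (2 * (l2norm b * √m)) := by
        rw [integral_const_mul]
        exact mul_le_mul_of_nonneg_left hsq hB0
    _ = _ := by ring

end RademacherComplexity

section PairBlocks

theorem exists_perm_apply_eq {α : Type*} [DecidableEq α] {a b c d : α} (hab : a ≠ b)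
    (hcd : c ≠ d) : ∃ τ : Equiv.Perm α, τ a = c ∧ τ b = d := by
  refine ⟨Equiv.swap (Equiv.swap a c b) d * Equiv.swap a c, ?_, by simp⟩
  rw [Equiv.Perm.mul_apply, Equiv.swap_apply_left, Equiv.swap_apply_of_ne_of_ne _ hcd]
  intro h
  apply hab
  apply (Equiv.swap a c).injective
  rw [← h, Equiv.swap_apply_left]

theorem mul_sum_perm_apply {n : ℕ} (H : Fin n → Fin n → ℝ) {a b : Fin n} (hab : a ≠ b) :
    (n : ℝ) * (n - 1) * ∑ σ : Equiv.Perm (Fin n), H (σ a) (σ b) =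
      n.factorial * ∑ i, ∑ j, if i ≠ j then H i j else 0 := by
  have hconst : ∀ c d : Fin n, c ≠ d →
      ∑ σ : Equiv.Perm (Fin n), H (σ c) (σ d) = ∑ σ : Equiv.Perm (Fin n), H (σ a) (σ b) := by
    intro c d hcd
    obtain ⟨τ, hc, hd⟩ := exists_perm_apply_eq hab hcd
    rw [← Equiv.sum_comp (Equiv.mulRight τ) fun σ => H (σ a) (σ b)]
    simp [hc, hd]
  have hperm : ∀ σ : Equiv.Perm (Fin n), (∑ c, ∑ d, if c ≠ d then H (σ c) (σ d) else 0) =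
      ∑ i, ∑ j, if i ≠ j then H i j else 0 := by
    intro σ
    rw [← Equiv.sum_comp σ fun i => ∑ j, if i ≠ j then H i j else 0]
    refine sum_congr rfl fun c _ => ?_
    rw [← Equiv.sum_comp σ fun j => if σ c ≠ j then H (σ c) j else 0]
    simp
  have hcount : ∀ T : ℝ, (∑ c : Fin n, ∑ d : Fin n, if c ≠ d then T else 0) =
      n * (n - 1) * T := by
    intro T
    have : ∀ c : Fin n, (∑ d : Fin n, if c ≠ d then T else 0) = (n - 1) * T := by
      intro c
      have h : ∀ d : Fin n, (if c ≠ d then T else 0) = T - if c = d then T else 0 := by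
        intro d
        split_ifs <;> simp_all
      simp only [h, sum_sub_distrib]
      simp
      ring
    simp only [this]
    simp
    ring
  calc (n : ℝ) * (n - 1) * ∑ σ : Equiv.Perm (Fin n), H (σ a) (σ b)
      = ∑ c, ∑ d, if c ≠ d then ∑ σ : Equiv.Perm (Fin n), H (σ c) (σ d) else 0 := by
        rw [← hcount]
        refine sum_congr rfl fun c _ => sum_congr rfl fun d _ => ?_
        split_ifs with h
        · exact (hconst c d h).symm
        · rfl
    _ = ∑ σ : Equiv.Perm (Fin n), ∑ c, ∑ d, if c ≠ d then H (σ c) (σ d) else 0 := by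
        symm
        rw [sum_comm]
        refine sum_congr rfl fun c _ => ?_
        rw [sum_comm]
        refine sum_congr rfl fun d _ => ?_
        split_ifs <;> simp
    _ = _ := by
        simp only [hperm]
        simp [Fintype.card_perm]

variable {Z : Type*} {m : ℕ}

/-- Pair up the entries of a sample of even size according to a permutation; within each pair
the entries keep the order of their indices. -/
def pairBlock (σ : Equiv.Perm (Fin (m + m))) (S : Fin (m + m) → Z) : Fin m → Z × Z :=
  fun j => (S (min (σ (Fin.castAdd m j)) (σ (Fin.natAdd m j))),
    S (max (σ (Fin.castAdd m j)) (σ (Fin.natAdd m j))))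

theorem sum_lt_eq_average_pairBlock (hm : 0 < m) (S : Fin (m + m) → Z) (h : Z → Z → ℝ) :
    2 / (((m + m : ℕ) : ℝ) * (((m + m : ℕ) : ℝ) - 1)) *
        ∑ i, ∑ j, (if i < j then h (S i) (S j) else 0) =
      (∑ σ : Equiv.Perm (Fin (m + m)), ∑ j, h (pairBlock σ S j).1 (pairBlock σ S j).2) /
        ((m + m).factorial * m) := by
  set T := ∑ i, ∑ j, (if i < j then h (S i) (S j) else 0) with hT
  have hsum : (∑ i, ∑ j, if i ≠ j then h (S (min i j)) (S (max i j)) else 0) = 2 * T := by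
    have hsplit : ∀ i j : Fin (m + m), (if i ≠ j then h (S (min i j)) (S (max i j)) else 0) =
        (if i < j then h (S i) (S j) else 0) + if j < i then h (S j) (S i) else 0 := by
      intro i j
      rcases lt_trichotomy i j with hij | hij | hij
      · simp [hij, hij.ne, hij.le, hij.not_gt]
      · simp [hij]
      · simp [hij, hij.ne', hij.le, hij.not_gt]
    simp only [hsplit, sum_add_distrib]
    rw [sum_comm (f := fun i j => if j < i then h (S j) (S i) else 0), two_mul]
  have hj : ∀ j : Fin m, ((m + m : ℕ) : ℝ) * (((m + m : ℕ) : ℝ) - 1) *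
      ∑ σ : Equiv.Perm (Fin (m + m)), h (pairBlock σ S j).1 (pairBlock σ S j).2 =
        (m + m).factorial * (2 * T) := by
    intro j
    rw [← hsum]
    refine mul_sum_perm_apply (fun i j => h (S (min i j)) (S (max i j))) ?_
    intro hne
    have := congrArg Fin.val hne
    simp at this
    omega
  have hm1 : (1 : ℝ) ≤ m := by exact_mod_cast hm
  have hpos : 0 < ((m + m : ℕ) : ℝ) * (((m + m : ℕ) : ℝ) - 1) := by
    push_cast
    exact mul_pos (by linarith) (by linarith)
  have hf : (0 : ℝ) < (m + m).factorial := by exact_mod_cast Nat.factorial_pos _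
  have htot : ((m + m : ℕ) : ℝ) * (((m + m : ℕ) : ℝ) - 1) *
      ∑ σ : Equiv.Perm (Fin (m + m)), ∑ j, h (pairBlock σ S j).1 (pairBlock σ S j).2 =
        m * ((m + m).factorial * (2 * T)) := by
    rw [sum_comm, mul_sum]
    simp only [hj]
    simp
  rw [eq_div_iff (by positivity), div_mul_eq_mul_div, div_mul_eq_mul_div, div_eq_iff hpos.ne',
    mul_comm (∑ σ : Equiv.Perm (Fin (m + m)), _), htot]
  ring

variable [MeasurableSpace Z]

theorem measurePreserving_pairs (D : Measure Z) [IsProbabilityMeasure D] {n : ℕ}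
    {s t : Fin m → Fin n} (hst : Function.Bijective (Sum.elim s t)) :
    MeasurePreserving (fun (S : Fin n → Z) j => (S (s j), S (t j)))
      (Measure.pi fun _ => D) (Measure.pi fun _ => D.prod D) := by
  have hmeas : Measurable fun (S : Fin n → Z) (j : Fin m) => (S (s j), S (t j)) := by fun_prop
  refine ⟨hmeas, ?_⟩
  symm
  refine Measure.pi_eq_generateFrom (fun _ => generateFrom_prod) (fun _ => isPiSystem_prod)
    (fun _ => ?_) fun A hA => ?_
  · exact {
      set := fun _ => Set.univ
      set_mem := fun _ => ⟨Set.univ, MeasurableSet.univ, Set.univ, MeasurableSet.univ, by simp⟩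
      finite := fun _ => by simp
      spanning := by simp [Set.iUnion_const] }
  · choose U hU V hV hUV using hA
    obtain rfl : (fun j => U j ×ˢ V j) = A := funext hUV
    rw [Measure.map_apply hmeas
      (MeasurableSet.univ_pi fun j => (hU j).prod (hV j))]
    set e := Equiv.ofBijective _ hst with he
    have hpre : (fun (S : Fin n → Z) (j : Fin m) => (S (s j), S (t j))) ⁻¹'
        Set.pi Set.univ (fun j => U j ×ˢ V j) =
        Set.pi Set.univ fun i => Sum.elim U V (e.symm i) := by
      ext S
      simp only [Set.mem_preimage, Set.mem_pi, Set.mem_univ, true_implies, Set.mem_prod]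
      rw [← e.forall_congr_right]
      simp [he, forall_and]
    rw [hpre, Measure.pi_pi, ← Equiv.prod_comp e]
    simp [Fintype.prod_sum_type, Measure.prod_prod, prod_mul_distrib]

theorem measurePreserving_pairBlock (D : Measure Z) [IsProbabilityMeasure D]
    (σ : Equiv.Perm (Fin (m + m))) :
    MeasurePreserving (pairBlock σ) (Measure.pi fun _ => D)
      (Measure.pi fun _ : Fin m => D.prod D) := by
  refine measurePreserving_pairs D
    (s := fun j => min (σ (Fin.castAdd m j)) (σ (Fin.natAdd m j)))
    (t := fun j => max (σ (Fin.castAdd m j)) (σ (Fin.natAdd m j))) ?_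
  rw [Fintype.bijective_iff_surjective_and_card]
  refine ⟨fun i => ?_, by simp⟩
  obtain ⟨i, rfl⟩ := σ.surjective i
  refine Fin.addCases (fun j => ?_) (fun j => ?_) i
  · rcases le_total (σ (Fin.castAdd m j)) (σ (Fin.natAdd m j)) with h | h
    · exact ⟨Sum.inl j, min_eq_left h⟩
    · exact ⟨Sum.inr j, max_eq_left h⟩
  · rcases le_total (σ (Fin.castAdd m j)) (σ (Fin.natAdd m j)) with h | h
    · exact ⟨Sum.inr j, max_eq_right h⟩
    · exact ⟨Sum.inl j, min_eq_right h⟩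

end PairBlocks

section PairAverage

variable {Z : Type*} {n : ℕ}

/-- The average of a two-argument function over all increasing pairs of sample entries. -/
def pairAvg (h : Z → Z → ℝ) (S : Fin n → Z) : ℝ :=
  2 / ((n : ℝ) * ((n : ℝ) - 1)) * ∑ i, ∑ j, if i < j then h (S i) (S j) else 0

theorem pairAvg_const (hn : 2 ≤ n) (a : ℝ) (S : Fin n → Z) : pairAvg (fun _ _ => a) S = a := by
  have h2 : (2 : ℝ) ≤ n := by exact_mod_cast hn
  have hpos : 0 < (n : ℝ) * ((n : ℝ) - 1) := mul_pos (by linarith) (by linarith)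
  have hswap : (∑ i : Fin n, ∑ j : Fin n, if i < j then a else 0) =
      ∑ i : Fin n, ∑ j : Fin n, if j < i then a else 0 := sum_comm
  have htot : (∑ i : Fin n, ∑ j : Fin n, if i < j then a else 0) +
      (∑ i : Fin n, ∑ j : Fin n, if j < i then a else 0) = n * (n - 1) * a := by
    rw [← sum_add_distrib]
    have hrow : ∀ i : Fin n, ((∑ j : Fin n, if i < j then a else 0) +
        ∑ j : Fin n, if j < i then a else 0) = (n - 1) * a := by
      intro i
      rw [← sum_add_distrib]
      have : ∀ j : Fin n, ((if i < j then a else 0) + if j < i then a else 0) =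
          a - if i = j then a else 0 := by
        intro j
        rcases lt_trichotomy i j with hij | hij | hij
        · simp [hij, hij.ne, hij.not_gt]
        · simp [hij]
        · simp [hij, hij.ne', hij.not_gt]
      simp only [this, sum_sub_distrib]
      simp
      ring
    simp only [hrow]
    simp
    ring
  rw [pairAvg, div_mul_eq_mul_div, div_eq_iff hpos.ne']
  linarith

theorem abs_pairAvg_le (hn : 2 ≤ n) {h : Z → Z → ℝ} {M : ℝ} (hM : ∀ z z', |h z z'| ≤ M)
    (S : Fin n → Z) : |pairAvg h S| ≤ M := by
  have h2 : (2 : ℝ) ≤ n := by exact_mod_cast hn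
  have hpos : 0 < (n : ℝ) * ((n : ℝ) - 1) := mul_pos (by linarith) (by linarith)
  rw [← pairAvg_const hn M S, pairAvg, pairAvg, abs_mul, abs_of_pos (by positivity)]
  refine mul_le_mul_of_nonneg_left ?_ (by positivity)
  refine (abs_sum_le_sum_abs _ _).trans (sum_le_sum fun i _ =>
    (abs_sum_le_sum_abs _ _).trans (sum_le_sum fun j _ => ?_))
  split_ifs
  · exact hM _ _
  · simp

theorem abs_pairAvg_update_sub_le (hn : 2 ≤ n) {h : Z → Z → ℝ} {M : ℝ}
    (h0 : ∀ z z', 0 ≤ h z z') (hM : ∀ z z', h z z' ≤ M) (S : Fin n → Z) (l : Fin n) (z : Z) :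
    |pairAvg h (Function.update S l z) - pairAvg h S| ≤ 2 * M / n := by
  have h2 : (2 : ℝ) ≤ n := by exact_mod_cast hn
  have hn1 : 0 < (n : ℝ) - 1 := by linarith
  have hn0 : 0 < (n : ℝ) := by linarith
  have hM0 : 0 ≤ M := (h0 z z).trans (hM z z)
  have hterm : ∀ i j : Fin n,
      |(if i < j then h (Function.update S l z i) (Function.update S l z j) else 0) -
        (if i < j then h (S i) (S j) else 0)| ≤
      (if i = l then if l < j then M else 0 else 0) +
        if j = l then if i < l then M else 0 else 0 := by
    intro i j
    have hdiff : ∀ a b a' b', |h a b - h a' b'| ≤ M := fun a b a' b' =>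
      abs_le.2 ⟨by linarith [h0 a b, hM a' b'], by linarith [h0 a' b', hM a b]⟩
    by_cases hij : i < j
    · by_cases hi : i = l
      · subst hi
        simp only [hij, if_true, lt_irrefl, if_false, ite_self, add_zero]
        exact hdiff _ _ _ _
      · by_cases hj : j = l
        · subst hj
          simp only [hij, if_true, hi, if_false, zero_add]
          exact hdiff _ _ _ _
        · simp [hi, hj]
    · simp only [hij, if_false, sub_self, abs_zero]
      split_ifs <;> simp [hM0]
  have hcount : ((∑ j : Fin n, if l < j then M else 0) + ∑ i : Fin n, if i < l then M else 0) =
      (n - 1) * M := by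
    rw [← sum_add_distrib]
    have : ∀ j : Fin n, ((if l < j then M else 0) + if j < l then M else 0) =
        M - if l = j then M else 0 := by
      intro j
      rcases lt_trichotomy l j with hij | hij | hij
      · simp [hij, hij.ne, hij.not_gt]
      · simp [hij]
      · simp [hij, hij.ne', hij.not_gt]
    simp only [this, sum_sub_distrib]
    simp
    ring
  rw [pairAvg, pairAvg, ← mul_sub, abs_mul, abs_of_pos (by positivity)]
  calc 2 / ((n : ℝ) * (n - 1)) *
        |(∑ i, ∑ j, if i < j then h (Function.update S l z i) (Function.update S l z j) else 0) -
          ∑ i, ∑ j, if i < j then h (S i) (S j) else 0|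
      ≤ 2 / ((n : ℝ) * (n - 1)) * ((n - 1) * M) := by
        refine mul_le_mul_of_nonneg_left ?_ (by positivity)
        rw [← hcount, ← sum_sub_distrib]
        simp only [← sum_sub_distrib]
        refine ((abs_sum_le_sum_abs _ _).trans (sum_le_sum fun i _ =>
          (abs_sum_le_sum_abs _ _).trans (sum_le_sum fun j _ => hterm i j))).trans_eq ?_
        simp only [sum_add_distrib]
        congr 1
        · simp
        · rw [sum_comm]
          simp
    _ = 2 * M / n := by
        field_simp

theorem abs_iSup_sub_iSup_le {ι : Type*} [Nonempty ι] {a b : ι → ℝ} {A c : ℝ}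
    (ha : ∀ k, |a k| ≤ A) (hb : ∀ k, |b k| ≤ A) (h : ∀ k, |a k - b k| ≤ c) :
    |(⨆ k, a k) - ⨆ k, b k| ≤ c := by
  rw [abs_sub_le_iff]
  constructor
  · rw [sub_le_iff_le_add]
    exact ciSup_le fun k => by
      linarith [(abs_le.1 (h k)).2, le_ciSup (bddAbove_range_of_abs_le hb) k]
  · rw [sub_le_iff_le_add]
    exact ciSup_le fun k => by
      linarith [(abs_le.1 (h k)).1, le_ciSup (bddAbove_range_of_abs_le ha) k]

variable [MeasurableSpace Z]

theorem measurable_pairAvg {h : Z → Z → ℝ} (hh : Measurable fun w : Z × Z => h w.1 w.2) :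
    Measurable fun S : Fin n → Z => pairAvg h S := by
  unfold pairAvg
  refine Measurable.const_mul (Finset.measurable_sum _ fun i _ => Finset.measurable_sum _
    fun j _ => ?_) _
  split_ifs
  · exact hh.comp (show Measurable fun S : Fin n → Z => (S i, S j) by fun_prop)
  · exact measurable_const

theorem integral_pairAvg (D : Measure Z) [IsProbabilityMeasure D] {m : ℕ} (hm : 0 < m)
    {h : Z → Z → ℝ} {M : ℝ} (hh : Measurable fun w : Z × Z => h w.1 w.2)
    (hM : ∀ z z', |h z z'| ≤ M) :
    ∫ S, pairAvg h S ∂(Measure.pi fun _ : Fin (m + m) => D) =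
      ∫ w, h w.1 w.2 ∂(D.prod D) := by
  have hcoord : ∀ (σ : Equiv.Perm (Fin (m + m))) (j : Fin m),
      MeasurePreserving (fun S : Fin (m + m) → Z => pairBlock σ S j)
        (Measure.pi fun _ => D) (D.prod D) := fun σ j =>
    (measurePreserving_eval (fun _ : Fin m => D.prod D) j).comp (measurePreserving_pairBlock D σ)
  have hinteg : ∀ (σ : Equiv.Perm (Fin (m + m))) (j : Fin m),
      Integrable (fun S : Fin (m + m) → Z => h (pairBlock σ S j).1 (pairBlock σ S j).2)
        (Measure.pi fun _ => D) := fun σ j =>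
    integrable_of_measurable_of_abs_le (hh.comp (hcoord σ j).measurable) fun S => hM _ _
  have heq : ∀ (σ : Equiv.Perm (Fin (m + m))) (j : Fin m),
      ∫ S, h (pairBlock σ S j).1 (pairBlock σ S j).2 ∂(Measure.pi fun _ => D) =
        ∫ w, h w.1 w.2 ∂(D.prod D) := fun σ j => by
    rw [← (hcoord σ j).map_eq, integral_map (hcoord σ j).measurable.aemeasurable
      hh.aestronglyMeasurable]
  have hm' : (0 : ℝ) < m := by exact_mod_cast hm
  have hf : (0 : ℝ) < (m + m).factorial := by exact_mod_cast Nat.factorial_pos _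
  simp only [pairAvg, sum_lt_eq_average_pairBlock hm]
  rw [integral_div, integral_finsetSum _ fun σ _ => integrable_finsetSum _ fun j _ => hinteg σ j]
  simp only [integral_finsetSum _ fun j _ => hinteg _ j, heq]
  simp [Fintype.card_perm]
  field_simp

variable {ι : Type*} [Nonempty ι] [Countable ι] {p : ℕ}

theorem integral_iSup_sub_pairAvg_le (D : Measure Z) [IsProbabilityMeasure D] {m : ℕ} (hm : 0 < m)
    {ξ : Z × Z → Fin p → ℝ} {b : Fin p → ℝ} (hξ : ∀ i, Measurable fun y => ξ y i)
    (hb : ∀ y i, |ξ y i| ≤ b i) {μ : ι → Fin p → ℝ} {B : ℝ} (hμ : ∀ k, l2norm (μ k) ≤ B)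
    {h : ι → Z → Z → ℝ} {C : ℝ} (hh : ∀ k, Measurable fun w : Z × Z => h k w.1 w.2)
    (hC : ∀ k z z', |h k z z'| ≤ C)
    (hlip : ∀ k l z z', |h k z z' - h l z z'| ≤ |ip (μ k) (ξ (z, z')) - ip (μ l) (ξ (z, z'))|) :
    ∫ S, ⨆ k, (∫ w, h k w.1 w.2 ∂(D.prod D) - pairAvg (h k) S)
        ∂(Measure.pi fun _ : Fin (m + m) => D) ≤ 2 * B * l2norm b * √(1 / m) := by
  set r : ι → ℝ := fun k => ∫ w, h k w.1 w.2 ∂(D.prod D) with hr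
  set Φ : (Fin m → Z × Z) → ℝ := fun W => ⨆ k, ∑ j, (r k - h k (W j).1 (W j).2) with hΦ
  have hrC : ∀ k, |r k| ≤ C := fun k => abs_integral_le_of_abs_le fun w => hC k _ _
  have hm' : (0 : ℝ) < m := by exact_mod_cast hm
  have hf : (0 : ℝ) < (m + m).factorial := by exact_mod_cast Nat.factorial_pos _
  have hmm : 2 ≤ m + m := by omega
  have hterm : ∀ k z z', |r k - h k z z'| ≤ C + C := fun k z z' =>
    (abs_sub _ _).trans (add_le_add (hrC k) (hC k z z'))
  have hsumC : ∀ k (W : Fin m → Z × Z), |∑ j, (r k - h k (W j).1 (W j).2)| ≤ m * (C + C) :=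
    fun k W => by
      simpa using abs_add_sum_le abs_zero.le fun j => hterm k (W j).1 (W j).2
  have hΦm : Measurable Φ := by
    refine Measurable.iSup fun k => Finset.measurable_sum _ fun j _ => ?_
    exact measurable_const.sub ((hh k).comp (measurable_pi_apply j))
  have hΦC : ∀ W, |Φ W| ≤ m * (C + C) := fun W => abs_iSup_le_of_abs_le fun k => hsumC k W
  have hblock : ∀ σ : Equiv.Perm (Fin (m + m)),
      ∫ S, Φ (pairBlock σ S) ∂(Measure.pi fun _ => D) = ∫ W, Φ W ∂(Measure.pi fun _ => D.prod D) :=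
    fun σ => by
      rw [← (measurePreserving_pairBlock D σ).map_eq,
        integral_map (measurePreserving_pairBlock D σ).measurable.aemeasurable
          hΦm.aestronglyMeasurable]
  have hinteg : ∀ σ : Equiv.Perm (Fin (m + m)),
      Integrable (fun S => Φ (pairBlock σ S)) (Measure.pi fun _ => D) := fun σ =>
    integrable_of_measurable_of_abs_le (hΦm.comp (measurePreserving_pairBlock D σ).measurable)
      fun S => hΦC _
  calc ∫ S, ⨆ k, (r k - pairAvg (h k) S) ∂(Measure.pi fun _ : Fin (m + m) => D)
      ≤ ∫ S, (∑ σ : Equiv.Perm (Fin (m + m)), Φ (pairBlock σ S)) / ((m + m).factorial * m)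
          ∂(Measure.pi fun _ : Fin (m + m) => D) := by
        refine integral_mono (integrable_of_measurable_of_abs_le (C := C + C) ?_ fun S => ?_)
          ((integrable_finsetSum _ fun σ _ => hinteg σ).div_const _) fun S => ciSup_le fun k => ?_
        · exact Measurable.iSup fun k => measurable_const.sub (measurable_pairAvg (hh k))
        · exact abs_iSup_le_of_abs_le fun k =>
            (abs_sub _ _).trans (add_le_add (hrC k) (abs_pairAvg_le hmm (hC k) S))
        · rw [pairAvg, sum_lt_eq_average_pairBlock hm, le_div_iff₀ (by positivity), sub_mul,
            div_mul_cancel₀ _ (by positivity)]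
          calc r k * ((m + m).factorial * m) -
                ∑ σ : Equiv.Perm (Fin (m + m)), ∑ j, h k (pairBlock σ S j).1 (pairBlock σ S j).2
              = ∑ σ : Equiv.Perm (Fin (m + m)),
                  ∑ j, (r k - h k (pairBlock σ S j).1 (pairBlock σ S j).2) := by
                simp only [sum_sub_distrib]
                simp [Fintype.card_perm]
                ring
            _ ≤ _ := sum_le_sum fun σ _ =>
                le_ciSup (bddAbove_range_of_abs_le fun k => hsumC k (pairBlock σ S)) k
    _ = (∫ W, Φ W ∂(Measure.pi fun _ => D.prod D)) / m := by
        rw [integral_div, integral_finsetSum _ fun σ _ => hinteg σ]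
        simp only [hblock]
        simp [Fintype.card_perm]
        field_simp
    _ ≤ 2 * B * (l2norm b * √m) / m := by
        refine div_le_div_of_nonneg_right ?_ hm'.le
        exact integral_iSup_sum_deviation_le (D.prod D) hξ hb hμ
          (f := fun k w => h k w.1 w.2) hh (fun k w => hC k w.1 w.2)
          (fun k l w => hlip k l w.1 w.2) m
    _ = 2 * B * l2norm b * √(1 / m) := by
        rw [Real.sqrt_div zero_le_one, Real.sqrt_one]
        have hs : √(m : ℝ) ≠ 0 := (Real.sqrt_pos.2 hm').ne'
        field_simp
        rw [Real.sq_sqrt (Nat.cast_nonneg m)]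

/-- McDiarmid's inequality at confidence level `δ` for the differences of a pair average. -/
theorem measureReal_deviation_le (D : Measure Z) [IsProbabilityMeasure D] (hn : 0 < n)
    {g : (Fin n → Z) → ℝ} {C M δ : ℝ} (hg : Measurable g) (hC : ∀ S, |g S| ≤ C) (hM : 0 < M)
    (hd : ∀ S i z, |g (Function.update S i z) - g S| ≤ 2 * M / n) (hδ0 : 0 < δ) (hδ1 : δ < 1) :
    (Measure.pi fun _ => D).real {S | M * √(2 * Real.log (1 / δ) / n) ≤
      g S - ∫ V, g V ∂(Measure.pi fun _ => D)} ≤ δ := by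
  have hn' : (0 : ℝ) < n := by exact_mod_cast hn
  have hL : 0 ≤ Real.log (1 / δ) := Real.log_nonneg (by rw [le_div_iff₀ hδ0]; linarith)
  refine (measureReal_ge_le_of_bounded_differences D hg hC hd (by positivity)).trans_eq ?_
  rw [mul_pow, Real.sq_sqrt (by positivity)]
  have : -(M ^ 2 * (2 * Real.log (1 / δ) / n)) / (2 * (n * (2 * M / n / 2) ^ 2)) =
      Real.log δ := by
    rw [one_div, Real.log_inv]
    field_simp
  rw [this, Real.exp_log hδ0]

end PairAverage

section HingeLoss

variable {X : Type*} {p : ℕ}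

theorem empRisk_eq_pairAvg {n : ℕ} (K : Fin p → X → X → ℝ) (S : Fin n → X × Bool)
    (μ : Fin p → ℝ) : empRisk K S μ = pairAvg (hinge K μ) S := rfl

theorem hinge_nonneg (K : Fin p → X → X → ℝ) (μ : Fin p → ℝ) (w w' : X × Bool) :
    0 ≤ hinge K μ w w' := le_max_left _ _

theorem ip_sgn_mul (K : Fin p → X → X → ℝ) (μ : Fin p → ℝ) (w w' : X × Bool) :
    ip μ (fun i => sgn w.2 * sgn w'.2 * K i w.1 w'.1) =
      sgn w.2 * sgn w'.2 * ip μ (zmap K w.1 w'.1) := by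
  simp only [ip, zmap, mul_sum]
  exact sum_congr rfl fun i _ => by ring

theorem abs_sgn_mul_sgn_mul (b b' : Bool) (a : ℝ) : |sgn b * sgn b' * a| = |a| := by
  rw [abs_mul, abs_mul, abs_sgn, abs_sgn, one_mul, one_mul]

theorem hinge_le {K : Fin p → X → X → ℝ} {b : Fin p → ℝ} (hK : ∀ i x x', |K i x x'| ≤ b i)
    (μ : Fin p → ℝ) (w w' : X × Bool) : hinge K μ w w' ≤ 1 + l2norm μ * l2norm b := by
  have h1 : |sgn w.2 * sgn w'.2 * ip μ (zmap K w.1 w'.1)| ≤ l2norm μ * l2norm b := by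
    rw [abs_sgn_mul_sgn_mul]
    exact (abs_ip_le _ _).trans (mul_le_mul_of_nonneg_left
      (l2norm_le_l2norm_of_abs_le fun i => hK i _ _) (l2norm_nonneg _))
  refine max_le ?_ ?_
  · linarith [abs_nonneg (sgn w.2 * sgn w'.2 * ip μ (zmap K w.1 w'.1))]
  · linarith [(abs_le.1 h1).1]

theorem abs_hinge_sub_hinge_le (K : Fin p → X → X → ℝ) (μ ν : Fin p → ℝ) (w w' : X × Bool) :
    |hinge K μ w w' - hinge K ν w w'| ≤
      |ip μ (fun i => sgn w.2 * sgn w'.2 * K i w.1 w'.1) -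
        ip ν fun i => sgn w.2 * sgn w'.2 * K i w.1 w'.1| := by
  rw [ip_sgn_mul, ip_sgn_mul]
  refine (abs_max_sub_max_le_max _ _ _ _).trans ?_
  rw [sub_self, abs_zero, max_eq_right (abs_nonneg _), sub_sub_sub_cancel_left, abs_sub_comm]

theorem continuous_hinge (K : Fin p → X → X → ℝ) (w w' : X × Bool) :
    Continuous fun μ => hinge K μ w w' := by
  unfold hinge ip
  fun_prop

theorem measurable_sgn_mul_kernel [MeasurableSpace X] {K : X → X → ℝ}
    (hK : Measurable fun w : X × X => K w.1 w.2) :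
    Measurable fun w : (X × Bool) × (X × Bool) => sgn w.1.2 * sgn w.2.2 * K w.1.1 w.2.1 := by
  have hs := measurable_sgn
  have hk : Measurable fun w : (X × Bool) × (X × Bool) => K w.1.1 w.2.1 :=
    hK.comp (show Measurable fun w : (X × Bool) × (X × Bool) => (w.1.1, w.2.1) by fun_prop)
  fun_prop

theorem measurable_hinge [MeasurableSpace X] {K : Fin p → X → X → ℝ}
    (hK : ∀ i, Measurable fun w : X × X => K i w.1 w.2) (μ : Fin p → ℝ) :
    Measurable fun w : (X × Bool) × (X × Bool) => hinge K μ w.1 w.2 := by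
  have h := fun i => measurable_sgn_mul_kernel (hK i)
  simp only [hinge, ← ip_sgn_mul]
  unfold ip
  fun_prop

theorem empRisk_zero {n : ℕ} (hn : 2 ≤ n) (K : Fin p → X → X → ℝ) (S : Fin n → X × Bool) :
    empRisk K S 0 = 1 := by
  have h : hinge K 0 = fun _ _ => (1 : ℝ) := by
    funext w w'
    simp [hinge, ip]
  rw [empRisk_eq_pairAvg, h, pairAvg_const hn]

theorem empRisk_nonneg {n : ℕ} (hn : 2 ≤ n) (K : Fin p → X → X → ℝ) (S : Fin n → X × Bool)
    (μ : Fin p → ℝ) : 0 ≤ empRisk K S μ := by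
  have h2 : (2 : ℝ) ≤ n := by exact_mod_cast hn
  have hpos : 0 ≤ (n : ℝ) * ((n : ℝ) - 1) := mul_nonneg (by linarith) (by linarith)
  refine mul_nonneg (by positivity) (sum_nonneg fun i _ => sum_nonneg fun j _ => ?_)
  split_ifs
  · exact hinge_nonneg _ _ _ _
  · exact le_rfl

theorem continuous_empRisk {n : ℕ} (K : Fin p → X → X → ℝ) (S : Fin n → X × Bool) :
    Continuous fun μ => empRisk K S μ := by
  have := fun w w' => continuous_hinge K w w'
  refine continuous_const.mul (continuous_finsetSum _ fun i _ => continuous_finsetSum _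
    fun j _ => ?_)
  split_ifs
  · exact this _ _
  · exact continuous_const

/-- Uniform deviation bound over a Euclidean ball, with probability at least `1 - δ`. -/
theorem exists_measureReal_le_and_trueRisk_le [MeasurableSpace X] {m : ℕ} (hm : 0 < m)
    {K : Fin p → X → X → ℝ} {b : Fin p → ℝ}
    (hKm : ∀ i, Measurable fun w : X × X => K i w.1 w.2) (hK : ∀ i x x', |K i x x'| ≤ b i)
    (D : Measure (X × Bool)) [IsProbabilityMeasure D] {B δ : ℝ} (hB : 0 ≤ B)
    (hδ0 : 0 < δ) (hδ1 : δ < 1) :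
    ∃ A : Set (Fin (m + m) → X × Bool), (Measure.pi fun _ => D).real A ≤ δ ∧
      ∀ S ∉ A, ∀ μ, l2norm μ ≤ B → trueRisk K D μ ≤ empRisk K S μ + 2 * B * l2norm b * √(1 / m) +
        (1 + B * l2norm b) * √(2 * Real.log (1 / δ) / (m + m : ℕ)) := by
  set M := 1 + B * l2norm b with hM
  have hM0 : 0 < M := by
    have := mul_nonneg hB (l2norm_nonneg b)
    linarith
  have hn : 2 ≤ m + m := by omega
  have hhM : ∀ μ, l2norm μ ≤ B → ∀ w w', hinge K μ w w' ≤ M := fun μ hμ w w' =>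
    (hinge_le hK μ w w').trans
      (by linarith [mul_le_mul_of_nonneg_right hμ (l2norm_nonneg b)])
  have habs : ∀ μ, l2norm μ ≤ B → ∀ w w', |hinge K μ w w'| ≤ M := fun μ hμ w w' => by
    rw [abs_of_nonneg (hinge_nonneg _ _ _ _)]
    exact hhM μ hμ w w'
  have : Nonempty {μ : Fin p → ℝ // l2norm μ ≤ B} := ⟨⟨0, by simpa [l2norm] using hB⟩⟩
  set d : ℕ → {μ : Fin p → ℝ // l2norm μ ≤ B} := TopologicalSpace.denseSeq _ with hd
  set Φ : (Fin (m + m) → X × Bool) → ℝ := fun S =>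
    ⨆ k, (trueRisk K D (d k) - pairAvg (hinge K (d k)) S) with hΦ
  have hR : ∀ k, |trueRisk K D (d k)| ≤ M := fun k =>
    abs_integral_le_of_abs_le fun w => habs _ (d k).2 _ _
  have hterm : ∀ k (S : Fin (m + m) → X × Bool),
      |trueRisk K D (d k) - pairAvg (hinge K (d k)) S| ≤ M + M := fun k S =>
    (abs_sub _ _).trans (add_le_add (hR k) (abs_pairAvg_le hn (habs _ (d k).2) S))
  have hΦm : Measurable Φ := Measurable.iSup fun k =>
    measurable_const.sub (measurable_pairAvg (measurable_hinge hKm _))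
  have hΦd : ∀ S i z, |Φ (Function.update S i z) - Φ S| ≤ 2 * M / (m + m : ℕ) := fun S i z =>
    abs_iSup_sub_iSup_le (fun k => hterm k _) (fun k => hterm k _) fun k => by
      rw [sub_sub_sub_cancel_left, abs_sub_comm]
      exact abs_pairAvg_update_sub_le hn (hinge_nonneg K _) (hhM _ (d k).2) S i z
  have hE : ∫ S, Φ S ∂(Measure.pi fun _ => D) ≤ 2 * B * l2norm b * √(1 / m) :=
    integral_iSup_sub_pairAvg_le D hm
      (ξ := fun w i => sgn w.1.2 * sgn w.2.2 * K i w.1.1 w.2.1)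
      (fun i => measurable_sgn_mul_kernel (hKm i))
      (fun w i => by
        rw [abs_sgn_mul_sgn_mul]
        exact hK _ _ _)
      (fun k => (d k).2) (fun k => measurable_hinge hKm _) (fun k => habs _ (d k).2)
      fun k l w w' => abs_hinge_sub_hinge_le K _ _ w w'
  refine ⟨_, measureReal_deviation_le D (by omega : 0 < m + m) hΦm
    (fun S => abs_iSup_le_of_abs_le fun k => hterm k S) hM0 hΦd hδ0 hδ1, fun S hS μ hμ => ?_⟩
  have hcont : Continuous fun ν : {μ : Fin p → ℝ // l2norm μ ≤ B} => trueRisk K D ν :=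
    continuous_of_dominated (bound := fun _ => M)
      (fun ν => (measurable_hinge hKm ν).aestronglyMeasurable)
      (fun ν => ae_of_all _ fun w => habs ν ν.2 _ _) (integrable_const _)
      (ae_of_all _ fun w => (continuous_hinge K _ _).comp continuous_subtype_val)
  have hsup : ∀ ν : {μ : Fin p → ℝ // l2norm μ ≤ B}, trueRisk K D ν - empRisk K S ν ≤ Φ S := by
    intro ν
    refine (TopologicalSpace.denseRange_denseSeq _).induction_on ν
      (isClosed_le (hcont.sub ((continuous_empRisk K S).comp continuous_subtype_val))
        continuous_const) fun k => ?_
    exact le_ciSup (bddAbove_range_of_abs_le fun k => hterm k S) k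
  have h1 := hsup ⟨μ, hμ⟩
  simp only [Set.mem_ofPred_eq, not_le] at hS
  simp only at h1
  linarith

/-- Upper tail bound for the empirical risk of a fixed vector. -/
theorem exists_measureReal_le_and_empRisk_le [MeasurableSpace X] {m : ℕ} (hm : 0 < m)
    {K : Fin p → X → X → ℝ} {b : Fin p → ℝ}
    (hKm : ∀ i, Measurable fun w : X × X => K i w.1 w.2) (hK : ∀ i x x', |K i x x'| ≤ b i)
    (D : Measure (X × Bool)) [IsProbabilityMeasure D] {δ : ℝ} (hδ0 : 0 < δ) (hδ1 : δ < 1)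
    (μ : Fin p → ℝ) :
    ∃ A : Set (Fin (m + m) → X × Bool), (Measure.pi fun _ => D).real A ≤ δ ∧
      ∀ S ∉ A, empRisk K S μ ≤ trueRisk K D μ +
        (1 + l2norm μ * l2norm b) * √(2 * Real.log (1 / δ) / (m + m : ℕ)) := by
  have hn : 2 ≤ m + m := by omega
  have hM0 : 0 < 1 + l2norm μ * l2norm b := by
    have := mul_nonneg (l2norm_nonneg μ) (l2norm_nonneg b)
    linarith
  have habs : ∀ w w', |hinge K μ w w'| ≤ 1 + l2norm μ * l2norm b := fun w w' => by
    rw [abs_of_nonneg (hinge_nonneg _ _ _ _)]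
    exact hinge_le hK μ w w'
  refine ⟨_, measureReal_deviation_le D (by omega : 0 < m + m)
    (measurable_pairAvg (measurable_hinge hKm μ)) (fun S => abs_pairAvg_le hn habs S) hM0
    (fun S i z => abs_pairAvg_update_sub_le hn (hinge_nonneg K μ) (hinge_le hK μ) S i z)
    hδ0 hδ1, fun S hS => ?_⟩
  rw [integral_pairAvg D hm (measurable_hinge hKm μ) habs] at hS
  simp only [Set.mem_ofPred_eq, not_le] at hS
  rw [empRisk_eq_pairAvg, trueRisk]
  linarith

end HingeLoss

/-- oracle-type bound for the L2-regularized empirical risk minimizer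
against an ε_o-combination-good vector μ_o. -/
theorem stmt11 {X : Type*} [MeasurableSpace X] {p n : ℕ} (hn : 2 ≤ n) (hev : Even n)
    (K : Fin p → X → X → ℝ)
    (hKm : ∀ i, Measurable (fun w : X × X => K i w.1 w.2))
    (κ : Fin p → ℝ) (hκ : ∀ i, 0 < κ i)
    (hKb : ∀ i x x', |K i x x'| ≤ κ i ^ 2)
    (D : Measure (X × Bool)) [IsProbabilityMeasure D]
    (lam : ℝ) (hlam : 0 < lam) (δ : ℝ) (hδ0 : 0 < δ) (hδ1 : δ < 1)
    (μo : Fin p → ℝ) (hμo : ∀ i, 0 ≤ μo i) (εo : ℝ) (hgood : trueRisk K D μo ≤ εo) :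
    ENNReal.ofReal (1 - 2 * δ) ≤
      (Measure.pi fun _ : Fin n => D) {S | ∀ muh : Fin p → ℝ, (∀ i, 0 ≤ muh i) →
        (∀ μ : Fin p → ℝ, (∀ i, 0 ≤ μ i) →
          lam / 2 * l2norm muh ^ 2 + empRisk K S muh ≤
            lam / 2 * l2norm μ ^ 2 + empRisk K S μ) →
        trueRisk K D muh ≤ εo + lam / 2 * l2norm μo ^ 2 +
          2 * l2norm μo * l2norm (fun i => κ i ^ 2) * Real.sqrt (2 / (n : ℝ)) +
          (1 + l2norm μo * l2norm (fun i => κ i ^ 2)) *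
            Real.sqrt (2 * Real.log (1 / δ) / n) +
          4 * l2norm (fun i => κ i ^ 2) * Real.sqrt (1 / (lam * n)) +
          (1 + l2norm (fun i => κ i ^ 2) * Real.sqrt (2 / lam)) *
            Real.sqrt (2 * Real.log (1 / δ) / n)} := by
  obtain ⟨m, rfl⟩ := hev
  have hm : 0 < m := by omega
  have hm' : (0 : ℝ) < m := by exact_mod_cast hm
  set b : Fin p → ℝ := fun i => κ i ^ 2 with hb
  set B : ℝ := √(2 / lam) with hB
  obtain ⟨A₁, hA₁, hbound₁⟩ := exists_measureReal_le_and_trueRisk_le hm hKm hKb D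
    (Real.sqrt_nonneg (2 / lam)) hδ0 hδ1
  obtain ⟨A₂, hA₂, hbound₂⟩ := exists_measureReal_le_and_empRisk_le hm hKm hKb D hδ0 hδ1 μo
  set P : Measure (Fin (m + m) → X × Bool) := Measure.pi fun _ => D with hP
  have hrad : 2 * B * l2norm b * √(1 / m) = 4 * l2norm b * √(1 / (lam * (m + m : ℕ))) := by
    have h4 : B * √(1 / m) = 2 * √(1 / (lam * (m + m : ℕ))) := by
      rw [hB, ← Real.sqrt_mul (by positivity), ← Real.sqrt_sq zero_le_two,
        ← Real.sqrt_mul (by positivity), Real.sqrt_sq zero_le_two]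
      congr 1
      push_cast
      field_simp
      ring
    linear_combination 2 * l2norm b * h4
  have hgoodset : ∀ S ∉ A₁ ∪ A₂, ∀ muh : Fin p → ℝ, (∀ i, 0 ≤ muh i) →
      (∀ μ : Fin p → ℝ, (∀ i, 0 ≤ μ i) →
        lam / 2 * l2norm muh ^ 2 + empRisk K S muh ≤ lam / 2 * l2norm μ ^ 2 + empRisk K S μ) →
      trueRisk K D muh ≤ εo + lam / 2 * l2norm μo ^ 2 +
        2 * l2norm μo * l2norm b * √(2 / ((m + m : ℕ) : ℝ)) +
        (1 + l2norm μo * l2norm b) * √(2 * Real.log (1 / δ) / (m + m : ℕ)) +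
        4 * l2norm b * √(1 / (lam * (m + m : ℕ))) +
        (1 + l2norm b * √(2 / lam)) * √(2 * Real.log (1 / δ) / (m + m : ℕ)) := by
    intro S hS muh _ hmin
    simp only [Set.mem_union, not_or] at hS
    have h0 := hmin 0 fun _ => le_rfl
    rw [empRisk_zero hn] at h0
    have hl0 : l2norm (0 : Fin p → ℝ) = 0 := by simp [l2norm]
    rw [hl0] at h0
    have hball : l2norm muh ≤ B := by
      refine Real.le_sqrt_of_sq_le ?_
      rw [le_div_iff₀ hlam]
      linarith [empRisk_nonneg hn K S muh]
    have h1 := hbound₁ S hS.1 muh hball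
    have h2 := hbound₂ S hS.2
    have h3 := hmin μo hμo
    have h4 : 0 ≤ lam / 2 * l2norm muh ^ 2 := by positivity
    have h5 : 0 ≤ 2 * l2norm μo * l2norm b * √(2 / ((m + m : ℕ) : ℝ)) := by
      have := l2norm_nonneg μo
      have := l2norm_nonneg b
      positivity
    rw [hrad, ← hB] at h1
    rw [mul_comm (l2norm b) B]
    linarith
  have hbad : P.real (A₁ ∪ A₂) ≤ 2 * δ :=
    (measureReal_union_le _ _).trans (by linarith)
  have hcompl : 1 ≤ P.real (A₁ ∪ A₂)ᶜ + P.real (A₁ ∪ A₂) := by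
    have := measureReal_union_le (μ := P) (A₁ ∪ A₂)ᶜ (A₁ ∪ A₂)
    rwa [Set.compl_union_self, probReal_univ] at this
  refine le_trans ?_ (measure_mono fun S hS => hgoodset S hS)
  exact ENNReal.ofReal_le_of_le_toReal (by
    change 1 - 2 * δ ≤ P.real (A₁ ∪ A₂)ᶜ
    linarith)
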